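/- Let ξ be a 4-dimensional subspace of ℝ⁷ admitting an orthonormal basis f₁, f₂, f₃, f₄ with ψ₀(f₁,f₂,f₃,f₄) = 1 (a coassociative 4-plane). Then the associative 3-form φ₀ vanishes identically on ξ, i.e. φ₀(x,y,z) = 0 for all x, y, z ∈ ξ. -/

import Mathlib

noncomputable section
open scoped RealInnerProductSpace

abbrev E7 := EuclideanSpace ℝ (Fin 7)

/-- `dxⁱ ∧ dxʲ ∧ dxᵏ` evaluated on `(x, y, z)` (indices 0-based). -/
def d3 (i j k : Fin 7) (x y z : E7) : ℝ :=
  Matrix.det !![x i, x j, x k; y i, y j, y k; z i, z j, z k]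

/-- `dxⁱ ∧ dxʲ ∧ dxᵏ ∧ dxˡ` evaluated on `(x, y, z, w)` (indices 0-based). -/
def d4 (i j k l : Fin 7) (x y z w : E7) : ℝ :=
  Matrix.det !![x i, x j, x k, x l; y i, y j, y k, y l;
                z i, z j, z k, z l; w i, w j, w k, w l]

/-- The associative 3-form
`φ₀ = dx¹²³ + dx¹⁴⁵ − dx¹⁶⁷ + dx²⁴⁶ + dx²⁵⁷ + dx³⁴⁷ − dx³⁵⁶` (1-based indices; here 0-based). -/
def phi (x y z : E7) : ℝ :=
  d3 0 1 2 x y z + d3 0 3 4 x y z - d3 0 5 6 x y z + d3 1 3 5 x y z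
    + d3 1 4 6 x y z + d3 2 3 6 x y z - d3 2 4 5 x y z

/-- The coassociative 4-form
`ψ₀ = dx⁴⁵⁶⁷ + dx²³⁶⁷ − dx²³⁴⁵ + dx¹³⁵⁷ + dx¹³⁴⁶ + dx¹²⁵⁶ − dx¹²⁴⁷` (1-based; here 0-based). -/
def psi (x y z w : E7) : ℝ :=
  d4 3 4 5 6 x y z w + d4 1 2 5 6 x y z w - d4 1 2 3 4 x y z w + d4 0 2 4 6 x y z w
    + d4 0 2 3 5 x y z w + d4 0 1 4 5 x y z w - d4 0 1 3 6 x y z w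


/-- The cross product determined by `phi`: `⟪cr y z, w⟫ = phi y z w`. -/
def cr (y z : E7) : E7 := WithLp.toLp 2 ![
  (y 1 * z 2 - y 2 * z 1) + (y 3 * z 4 - y 4 * z 3) - (y 5 * z 6 - y 6 * z 5),
  -(y 0 * z 2 - y 2 * z 0) + (y 3 * z 5 - y 5 * z 3) + (y 4 * z 6 - y 6 * z 4),
  (y 0 * z 1 - y 1 * z 0) + (y 3 * z 6 - y 6 * z 3) - (y 4 * z 5 - y 5 * z 4),
  -(y 0 * z 4 - y 4 * z 0) - (y 1 * z 5 - y 5 * z 1) - (y 2 * z 6 - y 6 * z 2),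
  (y 0 * z 3 - y 3 * z 0) - (y 1 * z 6 - y 6 * z 1) + (y 2 * z 5 - y 5 * z 2),
  (y 0 * z 6 - y 6 * z 0) + (y 1 * z 3 - y 3 * z 1) - (y 2 * z 4 - y 4 * z 2),
  -(y 0 * z 5 - y 5 * z 0) + (y 1 * z 4 - y 4 * z 1) + (y 2 * z 3 - y 3 * z 2)]

/-- Coordinate dot product. -/
def dt (x y : E7) : ℝ :=
  x 0 * y 0 + x 1 * y 1 + x 2 * y 2 + x 3 * y 3 + x 4 * y 4 + x 5 * y 5 + x 6 * y 6

lemma dt_eq (x y : E7) : dt x y = inner ℝ x y := by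
  simp [dt, PiLp.inner_apply, Fin.sum_univ_succ]
  ring

lemma d3_eq (i j k : Fin 7) (x y z : E7) : d3 i j k x y z =
    x i * (y j * z k - y k * z j) - x j * (y i * z k - y k * z i)
      + x k * (y i * z j - y j * z i) := by
  simp [d3, Matrix.det_fin_three]
  ring

lemma d4_eq (i j k l : Fin 7) (x y z w : E7) : d4 i j k l x y z w =
    x i * d3 j k l y z w - x j * d3 i k l y z w + x k * d3 i j l y z w
      - x l * d3 i j k y z w := by
  simp [d4, d3_eq, Matrix.det_succ_row_zero, Fin.sum_univ_succ, Fin.succAbove]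
  ring

lemma phi_eq (x y z : E7) : phi x y z = dt x (cr y z) := by
  simp [phi, d3_eq, dt, cr]
  ring

lemma cr_sq (y z : E7) :
    dt (cr y z) (cr y z) = dt y y * dt z z - dt y z ^ 2 := by
  simp [dt, cr]
  ring

lemma psi_eq (x y z w : E7) :
    psi x y z w = -dt x (cr y (cr z w)) - dt x w * dt y z + dt x z * dt y w := by
  simp [psi, d4_eq, d3_eq, dt, cr]
  ring

lemma psi_rot (x y z w : E7) : psi y z w x = - psi x y z w := by
  simp only [psi, d4_eq, d3_eq]
  ring

lemma phi_rot (x y z : E7) : phi y z x = phi x y z := by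
  simp only [phi, d3_eq]
  ring

lemma phi_swap (x y z : E7) : phi x z y = - phi x y z := by
  simp only [phi, d3_eq]
  ring

lemma phi_add (x x' y z : E7) : phi (x + x') y z = phi x y z + phi x' y z := by
  simp only [phi_eq, dt, PiLp.add_apply]
  ring

lemma phi_smul (a : ℝ) (x y z : E7) : phi (a • x) y z = a * phi x y z := by
  simp only [phi_eq, dt, PiLp.smul_apply, smul_eq_mul]
  ring

lemma key (x y z w : E7) (hx : dt x x = 1) (hy : dt y y = 1) (hz : dt z z = 1)
    (hw : dt w w = 1) (xz : dt x z = 0) (xw : dt x w = 0)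
    (yz : dt y z = 0) (zw : dt z w = 0)
    (h : psi x y z w ^ 2 = 1) : phi y z w = 0 := by
  have h1 := cr_sq z w
  have h2 := cr_sq y (cr z w)
  rw [h1, hy, hz, hw, zw] at h2
  rw [phi_eq]
  rw [psi_eq, xz, xw, yz] at h
  have h3 := real_inner_mul_inner_self_le x (cr y (cr z w))
  simp only [← dt_eq] at h3
  rw [hx, h2] at h3
  have h4 : dt y (cr z w) ^ 2 ≤ 0 := by nlinarith
  exact pow_eq_zero_iff (two_ne_zero) |>.1 (le_antisymm h4 (sq_nonneg _))

lemma alt_zero (T : Fin 4 → Fin 4 → Fin 4 → ℝ) (hr : ∀ i j l, T j l i = T i j l)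
    (hs : ∀ i j l, T i l j = - T i j l) (q0 : T 1 2 3 = 0) (q1 : T 2 3 0 = 0)
    (q2 : T 3 0 1 = 0) (q3 : T 0 1 2 = 0) : ∀ i j l, T i j l = 0 := by
  intro i j l
  have e1 := hr i j l
  have e2 := hr j l i
  have e3 := hs i j l
  have e4 := hs j l i
  have e5 := hs l i j
  have c : ∀ i : Fin 4, i = 0 ∨ i = 1 ∨ i = 2 ∨ i = 3 := by decide
  clear hr hs
  rcases c i with rfl | rfl | rfl | rfl <;> rcases c j with rfl | rfl | rfl | rfl <;>
    rcases c l with rfl | rfl | rfl | rfl <;> linarith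

lemma phi_span (f : Fin 4 → E7) (y z : E7) (h : ∀ i, phi (f i) y z = 0) :
    ∀ x ∈ Submodule.span ℝ (Set.range f), phi x y z = 0 := by
  intro x hx
  induction hx using Submodule.span_induction with
  | mem x hx => obtain ⟨i, rfl⟩ := hx; exact h i
  | zero => simpa using phi_smul 0 0 y z
  | add a b _ _ ha hb => rw [phi_add, ha, hb, add_zero]
  | smul a b _ hb => rw [phi_smul, hb, mul_zero]

/-- the associative 3-form φ₀ vanishes identically on any coassociative
4-plane, i.e. any 4-dimensional subspace ξ ⊂ ℝ⁷ with an orthonormal basis `f`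
satisfying `ψ₀(f₁,f₂,f₃,f₄) = 1`. -/
theorem phi_vanishes_on_coassociative_plane
    (ξ : Submodule ℝ E7) (hdim : Module.finrank ℝ ξ = 4)
    (f : Fin 4 → E7) (hmem : ∀ i, f i ∈ ξ) (horth : Orthonormal ℝ f)
    (hcal : psi (f 0) (f 1) (f 2) (f 3) = 1) :
    ∀ x ∈ ξ, ∀ y ∈ ξ, ∀ z ∈ ξ, phi x y z = 0 := by
  have hspan : Submodule.span ℝ (Set.range f) = ξ := by
    apply Submodule.eq_of_le_of_finrank_eq
    · rw [Submodule.span_le]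
      rintro _ ⟨i, rfl⟩
      exact hmem i
    · rw [finrank_span_eq_card horth.linearIndependent, hdim]
      rfl
  have h1 : ∀ i, dt (f i) (f i) = 1 := fun i => by
    rw [dt_eq, real_inner_self_eq_norm_sq, horth.1 i]
    norm_num
  have h0 : ∀ i j, i ≠ j → dt (f i) (f j) = 0 := fun i j hij => by
    rw [dt_eq]
    exact horth.2 hij
  have hrot : ∀ x y z w : E7, psi x y z w ^ 2 = 1 → psi y z w x ^ 2 = 1 := by
    intro x y z w h
    rw [psi_rot, neg_sq, h]
  have p0 : psi (f 0) (f 1) (f 2) (f 3) ^ 2 = 1 := by rw [hcal]; norm_num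
  have p1 := hrot _ _ _ _ p0
  have p2 := hrot _ _ _ _ p1
  have p3 := hrot _ _ _ _ p2
  have k : ∀ a b c d : Fin 4, a ≠ c → a ≠ d → b ≠ c → c ≠ d →
      psi (f a) (f b) (f c) (f d) ^ 2 = 1 → phi (f b) (f c) (f d) = 0 :=
    fun a b c d ac ad bc cd h => key _ _ _ _ (h1 a) (h1 b) (h1 c) (h1 d)
      (h0 _ _ ac) (h0 _ _ ad) (h0 _ _ bc) (h0 _ _ cd) h
  have q0 := k 0 1 2 3 (by decide) (by decide) (by decide) (by decide) p0
  have q1 := k 1 2 3 0 (by decide) (by decide) (by decide) (by decide) p1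
  have q2 := k 2 3 0 1 (by decide) (by decide) (by decide) (by decide) p2
  have q3 := k 3 0 1 2 (by decide) (by decide) (by decide) (by decide) p3
  have base : ∀ i j l, phi (f i) (f j) (f l) = 0 := by
    exact alt_zero (fun i j l => phi (f i) (f j) (f l)) (fun _ _ _ => phi_rot _ _ _)
      (fun _ _ _ => phi_swap _ _ _) q0 q1 q2 q3
  rw [← hspan]
  intro x hx y hy z hz
  refine phi_span f y z (fun i => ?_) x hx
  rw [← phi_rot]
  refine phi_span f z (f i) (fun j => ?_) y hy
  rw [← phi_rot]
  refine phi_span f (f i) (f j) (fun l => base _ _ _) z hz
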